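/- Suppose f is good with right derivative satisfying f′(x) ≤ 1/(2(x+1)), and let M_f be the generic structure. Let ā be a finite tuple and b an element of M_f with b ∉ acl(ā), and let P = loc(b/ā), the set of realizations in M_f of the complete type of b over ā. Then for every r ∈ ℕ and every r-tuple ȳ from M_f there is an (r+2)-tuple x̄ ∈ P^{r+2} such that every entry of ȳ lies in acl(x̄ ∪ ā). -/

import Mathlib

open FirstOrder Set

namespace MeasureAmalgamation

variable (L : FirstOrder.Language)

/-- The predimension `δ(A) = |A| − Σ_i |R_i[A]|` of a (finite) subset `A` of an
`L`-structure: the number of points minus the number of relation instances inside `A`. -/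
noncomputable def delta {N : Type*} [L.Structure N] (A : Set N) : ℤ :=
  (A.ncard : ℤ) -
    (Set.ncard {p : Σ n, L.Relations n × (Fin n → N) |
      (∀ i, p.2.2 i ∈ A) ∧ Language.Structure.RelMap p.2.1 p.2.2} : ℤ)

/-- `A ≤ B` (`A` is self-sufficient in `B`): `A ⊆ B` and `δ(A) < δ(B′)` whenever
`A ⊊ B′ ⊆ B` with `B′` finite. -/
def SelfSuffIn {N : Type*} [L.Structure N] (A B : Set N) : Prop :=
  A ⊆ B ∧ ∀ B' : Set N, A ⊂ B' → B' ⊆ B → B'.Finite → delta L A < delta L B'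

/-- `A ≤ M` for the (possibly infinite) ambient structure:
`A ∩ X ≤ X` for every finite `X ⊆ M`. -/
def SelfSuffM {N : Type*} [L.Structure N] (A : Set N) : Prop :=
  ∀ X : Set N, X.Finite → SelfSuffIn L (A ∩ X) X

/-- The closure `cl_B(X)`: the smallest self-sufficient subset of `B` containing `X`. -/
def clIn {N : Type*} [L.Structure N] (X B : Set N) : Set N :=
  ⋂₀ {A : Set N | X ⊆ A ∧ SelfSuffIn L A B}

/-- The dimension `d^B(X) = δ(cl_B(X))`. -/
noncomputable def dIn {N : Type*} [L.Structure N] (X B : Set N) : ℤ :=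
  delta L (clIn L X B)

/-- The closure `cl_M(X)` in the ambient structure. -/
def clM {N : Type*} [L.Structure N] (X : Set N) : Set N :=
  ⋂₀ {A : Set N | X ⊆ A ∧ SelfSuffM L A}

/-- The dimension `d(X) = δ(cl_M(X))` in the ambient structure. -/
noncomputable def dM {N : Type*} [L.Structure N] (X : Set N) : ℤ :=
  delta L (clM L X)

/-- Membership in the class `K_f`: every (finite) subset `X` satisfies
`δ(X) ≥ f(|X|)`. -/
def InKf (f : ℝ → ℝ) (B : Type*) [L.Structure B] : Prop :=
  ∀ X : Set B, X.Finite → f X.ncard ≤ (delta L X : ℝ)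

/-- `f` is a good function (continuous, increasing, unbounded) certified by the standard
conditions guaranteeing the free amalgamation property for `(K_f, ≤)`: `f` has a
non-increasing right derivative `g` with `g(x) ≤ 1/(x+1)`. -/
structure IsGoodFun (f g : ℝ → ℝ) : Prop where
  cont : ContinuousOn f (Set.Ici 0)
  mono : StrictMonoOn f (Set.Ici 0)
  unbounded : Filter.Tendsto f Filter.atTop Filter.atTop
  rightDeriv : ∀ x ∈ Set.Ici (0 : ℝ), HasDerivWithinAt f (g x) (Set.Ici x) x
  anti : AntitoneOn g (Set.Ici 0)
  bound : ∀ x ∈ Set.Ici (0 : ℝ), g x ≤ 1 / (x + 1)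

/-- Any subset of a structure in a relational language is (the carrier of) a
substructure. -/
def relSub {N : Type*} [L.Structure N] [L.IsRelational] (A : Set N) :
    L.Substructure N where
  carrier := A
  fun_mem := fun {_} f => isEmptyElim f

/-- `N` is the generic structure `M_f` of the amalgamation class `(K_f, ≤)`:
(1) `N` is the union of a chain of finite self-sufficient substructures, all in `K_f`;
(2) (`≤`-extension property) if `A ≤ N` is finite and `A ≤ B ∈ K_f`, then there is a
`≤`-embedding `β : B → N` fixing `A` pointwise. -/
def IsGeneric {N : Type*} [L.Structure N] [L.IsRelational] (f : ℝ → ℝ) : Prop :=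
  (∃ c : ℕ → Set N, Monotone c ∧ (∀ k, (c k).Finite) ∧ (∀ k, SelfSuffM L (c k)) ∧
    (∀ (k : ℕ) (X : Set N), X ⊆ c k → f X.ncard ≤ (delta L X : ℝ)) ∧
    (⋃ k, c k) = Set.univ) ∧
  (∀ A : Set N, A.Finite → SelfSuffM L A →
    ∀ (B : Type) (_ : Fintype B) (_ : L.Structure B), InKf L f B →
      ∀ e : ↥(relSub L A) ↪[L] B,
        SelfSuffIn L (Set.range ⇑e) (Set.univ : Set B) →
        ∃ g : B ↪[L] N, (∀ a : ↥(relSub L A), g (e a) = ↑a) ∧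
          SelfSuffM L (Set.range ⇑g))

/-- Two tuples have the same complete type over `∅`. -/
def sameType {N : Type*} [L.Structure N] {k : ℕ} (a a' : Fin k → N) : Prop :=
  ∀ φ : L.Formula (Fin k), φ.Realize a ↔ φ.Realize a'

/-- The locus `loc(b̄/ā)`: the set of realizations in `N` of the complete type of `b̄`
over `ā`. -/
def locus {N : Type*} [L.Structure N] {k m : ℕ} (a : Fin k → N) (b : Fin m → N) :
    Set (Fin m → N) :=
  {y | sameType L (Fin.append a y) (Fin.append a b)}

/-- A subset of `M` viewed as a subset of the power `M^{Fin 1}`. -/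
def toDef1 (M : Type*) (s : Set M) : Set (Fin 1 → M) := {x | x 0 ∈ s}

/-- Algebraic closure: `b ∈ acl(Z)` iff `b` belongs to some finite `Z`-definable set. -/
def inAcl {M : Type*} [L.Structure M] (Z : Set M) (b : M) : Prop :=
  ∃ s : Set M, b ∈ s ∧ s.Finite ∧ Z.Definable L (toDef1 M s)


section basics

open Classical in
/-- Relation instances inside `A`. -/
def relSet {N : Type} [L.Structure N] (A : Set N) :
    Set (Σ n, L.Relations n × (Fin n → N)) :=
  {p | (∀ i, p.2.2 i ∈ A) ∧ Language.Structure.RelMap p.2.1 p.2.2}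

variable {L}
variable {N : Type} [L.Structure N]

lemma delta_eq (A : Set N) : delta L A = (A.ncard : ℤ) - ((relSet L A).ncard : ℤ) := rfl

lemma relSet_mono {A B : Set N} (h : A ⊆ B) : relSet L A ⊆ relSet L B :=
  fun _ hp => ⟨fun i => h (hp.1 i), hp.2⟩

lemma relSet_inter (A B : Set N) : relSet L (A ∩ B) = relSet L A ∩ relSet L B := by
  ext p
  simp only [relSet, Set.mem_inter_iff, Set.mem_ofPred_eq]
  constructor
  · rintro ⟨h, h'⟩
    exact ⟨⟨fun i => (h i).1, h'⟩, ⟨fun i => (h i).2, h'⟩⟩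
  · rintro ⟨⟨h, h'⟩, ⟨h2, _⟩⟩
    exact ⟨fun i => ⟨h i, h2 i⟩, h'⟩

lemma tuples_finite [Finite (Σ n, L.Relations n)] {M : Type} {A : Set M} (hA : A.Finite) :
    {p : Σ n, L.Relations n × (Fin n → M) | ∀ i, p.2.2 i ∈ A}.Finite := by
  have : Finite A := hA
  let F : (Σ q : (Σ n, L.Relations n), (Fin q.1 → A)) → (Σ n, L.Relations n × (Fin n → M)) :=
    fun q => ⟨q.1.1, q.1.2, fun i => (q.2 i : M)⟩
  refine (Set.finite_range F).subset ?_
  rintro ⟨n, R, t⟩ h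
  exact ⟨⟨⟨n, R⟩, fun i => ⟨t i, h i⟩⟩, rfl⟩

lemma relSet_finite [Finite (Σ n, L.Relations n)] {A : Set N} (hA : A.Finite) :
    (relSet L A).Finite :=
  (tuples_finite hA).subset fun _ hp => hp.1

lemma submod [Finite (Σ n, L.Relations n)] {A B : Set N} (hA : A.Finite) (hB : B.Finite) :
    delta L (A ∪ B) + delta L (A ∩ B) ≤ delta L A + delta L B := by
  have h1 := Set.ncard_union_add_ncard_inter A B hA hB
  have h2 := Set.ncard_union_add_ncard_inter (relSet L A) (relSet L B)
    (relSet_finite hA) (relSet_finite hB)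
  have h3 : (relSet L A ∪ relSet L B).ncard ≤ (relSet L (A ∪ B)).ncard :=
    Set.ncard_le_ncard (Set.union_subset (relSet_mono Set.subset_union_left)
      (relSet_mono Set.subset_union_right)) (relSet_finite (hA.union hB))
  simp only [delta_eq, relSet_inter]
  omega

/-- strong finite sets -/
lemma ss_lt {A B : Set N} (h : SelfSuffM L A) (hB : B.Finite) (hAB : A ⊂ B) :
    delta L A < delta L B := by
  have := (h B hB).2 B
  rw [Set.inter_eq_left.2 hAB.1] at this
  exact this hAB subset_rfl hB

lemma ss_of_lt [Finite (Σ n, L.Relations n)] {A : Set N} (hA : A.Finite)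
    (h : ∀ B : Set N, B.Finite → A ⊂ B → delta L A < delta L B) : SelfSuffM L A := by
  intro X hX
  refine ⟨Set.inter_subset_right, fun B' hB hBX hfin => ?_⟩
  have e : A ∩ B' = A ∩ X := by
    apply Set.Subset.antisymm (Set.inter_subset_inter_right _ hBX)
    exact fun x hx => ⟨hx.1, hB.1 hx⟩
  have hs := submod (L := L) hA hfin
  rw [e] at hs
  have : A ⊂ A ∪ B' := by
    refine ⟨Set.subset_union_left, fun hh => hB.2 fun x hx => ⟨hh (Or.inr hx), hBX hx⟩⟩
  have := h _ (hA.union hfin) this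
  omega

/-- cutting by a strong set -/
lemma ss_cut {A X : Set N} (h : SelfSuffM L A) (hX : X.Finite) (hne : ¬ X ⊆ A) :
    delta L (A ∩ X) < delta L X :=
  (h X hX).2 X ⟨Set.inter_subset_right, fun hh => hne fun _ hx => (hh hx).1⟩ subset_rfl hX

lemma ss_cut_le {A X : Set N} (h : SelfSuffM L A) (hX : X.Finite) :
    delta L (A ∩ X) ≤ delta L X := by
  by_cases hne : X ⊆ A
  · rw [Set.inter_eq_right.2 hne]
  · exact (ss_cut h hX hne).le

lemma ss_inter [Finite (Σ n, L.Relations n)] {A B : Set N} (hA : SelfSuffM L A)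
    (hB : SelfSuffM L B) (hf : A.Finite) : SelfSuffM L (B ∩ A) := by
  refine ss_of_lt (hf.subset Set.inter_subset_right) fun X hX hlt => ?_
  by_cases hXA : X ⊆ A
  · have h : ¬ X ⊆ B := fun h => hlt.2 fun x hx => ⟨h hx, hXA hx⟩
    have := ss_cut hB hX h
    have e : B ∩ X = B ∩ A :=
      Set.Subset.antisymm (Set.inter_subset_inter_right _ hXA) fun x hx => ⟨hx.1, hlt.1 hx⟩
    rwa [e] at this
  · have h1 := ss_cut hA hX hXA
    have h2 := ss_cut_le hB (hX.subset (Set.inter_subset_right : A ∩ X ⊆ X))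
    have e : B ∩ (A ∩ X) = B ∩ A :=
      Set.Subset.antisymm (fun x hx => ⟨hx.1, hx.2.1⟩) fun x hx => ⟨hx.1, hx.2, hlt.1 hx⟩
    rw [e] at h2
    omega

/-- delta is preserved by embeddings -/
lemma relSet_image [L.IsRelational] {M : Type} [L.Structure M] (g : M ↪[L] N) (X : Set M) :
    relSet L (g '' X) = (fun p : Σ n, L.Relations n × (Fin n → M) =>
      (⟨p.1, p.2.1, g ∘ p.2.2⟩ : Σ n, L.Relations n × (Fin n → N))) '' relSet L X := by
  ext ⟨n, R, t⟩
  constructor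
  · rintro ⟨h1, h2⟩
    choose s hs hst using h1
    have e : g ∘ s = t := funext hst
    refine ⟨⟨n, R, s⟩, ⟨hs, ?_⟩, by simp [e]⟩
    have h2' : Language.Structure.RelMap R t := h2
    rw [← e] at h2'
    exact (g.map_rel R s).1 h2'
  · rintro ⟨⟨m, S, s⟩, ⟨h1, h2⟩, h3⟩
    rw [← h3]
    exact ⟨fun i => ⟨s i, h1 i, rfl⟩, (g.map_rel S s).2 h2⟩

lemma delta_image [L.IsRelational] {M : Type} [L.Structure M] (g : M ↪[L] N) (X : Set M) :
    delta L (g '' X) = delta L X := by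
  rw [delta_eq, delta_eq, relSet_image, Set.ncard_image_of_injective _ g.injective,
    Set.ncard_image_of_injective]
  rintro ⟨n, R, s⟩ ⟨m, S, t⟩ h
  simp only [Sigma.mk.injEq] at h
  obtain ⟨rfl, h⟩ := h
  simp only [heq_eq_eq, Prod.mk.injEq] at h
  obtain ⟨rfl, h⟩ := h
  have := g.injective.comp_left h
  rw [this]

lemma ss_comp [L.IsRelational] [Finite (Σ n, L.Relations n)] {M P : Type} [L.Structure M]
    [Finite M] [L.Structure P] (g : M ↪[L] N) (e : P ↪[L] M) (hg : SelfSuffM L (Set.range g))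
    (he : SelfSuffIn L (Set.range e) (Set.univ : Set M)) :
    SelfSuffM L (Set.range (g.comp e)) := by
  have hr : Set.range (g.comp e) = g '' Set.range e := by
    rw [← Set.range_comp]; rfl
  rw [hr]
  refine ss_of_lt ((Set.toFinite _).image _) fun B hB hlt => ?_
  have e1 : Set.range g ∩ B = g '' (g ⁻¹' B) := by
    rw [Set.image_preimage_eq_inter_range, Set.inter_comm]
  have hsub : Set.range e ⊆ g ⁻¹' B := fun x hx => hlt.1 ⟨x, hx, rfl⟩
  rw [delta_image]
  by_cases hBr : B ⊆ Set.range g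
  · have e2 : B = g '' (g ⁻¹' B) := by rw [← e1, Set.inter_eq_right.2 hBr]
    rw [e2, delta_image]
    refine he.2 _ ⟨hsub, fun hh => hlt.2 ?_⟩ (Set.subset_univ _) (Set.toFinite _)
    rw [e2]; exact Set.image_mono hh
  · have h1 := ss_cut hg hB hBr
    rw [e1, delta_image] at h1
    by_cases h : g ⁻¹' B ⊆ Set.range e
    · rwa [Set.Subset.antisymm h hsub] at h1
    · exact (he.2 _ ⟨hsub, h⟩ (Set.subset_univ _) (Set.toFinite _)).trans h1

/-- minimal strong superset -/
lemma exists_cl [Finite (Σ n, L.Relations n)] {Z : Set N}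
    (hZ : ∃ C : Set N, C.Finite ∧ SelfSuffM L C ∧ Z ⊆ C) :
    ∃ C : Set N, C.Finite ∧ SelfSuffM L C ∧ Z ⊆ C ∧
      ∀ W, SelfSuffM L W → Z ⊆ W → C ⊆ W := by
  classical
  have hex : ∃ n, ∃ C : Set N, C.Finite ∧ SelfSuffM L C ∧ Z ⊆ C ∧ C.ncard = n := by
    obtain ⟨C, h1, h2, h3⟩ := hZ
    exact ⟨_, C, h1, h2, h3, rfl⟩
  obtain ⟨C, h1, h2, h3, h4⟩ := Nat.find_spec hex
  refine ⟨C, h1, h2, h3, fun W hW hZW => ?_⟩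
  have hm := Nat.find_min' hex ⟨W ∩ C, h1.subset Set.inter_subset_right, ss_inter h2 hW h1,
    Set.subset_inter hZW h3, rfl⟩
  rw [← h4] at hm
  have := Set.eq_of_subset_of_ncard_le (Set.inter_subset_right : W ∩ C ⊆ C) hm h1
  exact Set.inter_eq_right.1 this

lemma cl_min [Finite (Σ n, L.Relations n)] {Z C : Set N} (hC : C.Finite) (hCs : SelfSuffM L C)
    (hmin : ∀ W, SelfSuffM L W → Z ⊆ W → C ⊆ W) {D : Set N} (hZD : Z ⊆ D) (hDC : D ⊆ C) :
    delta L C ≤ delta L D := by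
  -- strong induction on |C \ D|
  induction hn : (C \ D).ncard using Nat.strong_induction_on generalizing D with
  | _ n ih =>
    by_cases hD : SelfSuffM L D
    · rw [Set.Subset.antisymm hDC (hmin D hD hZD)]
    · have hDf := hC.subset hDC
      have : ∃ B : Set N, B.Finite ∧ D ⊂ B ∧ delta L B ≤ delta L D := by
        by_contra hcon
        push Not at hcon
        exact hD (ss_of_lt hDf hcon)
      obtain ⟨B, hB, hDB, hle⟩ := this
      have h1 := ss_cut_le hCs hB
      by_cases hBD : C ∩ B ⊆ D
      · -- then C ∩ B = D
        have e : C ∩ B = D := Set.Subset.antisymm hBD fun x hx => ⟨hDC hx, hDB.1 hx⟩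
        have hne : ¬ B ⊆ C := fun h => hDB.2 fun x hx => hBD ⟨h hx, hx⟩
        have := ss_cut hCs hB hne
        rw [e] at this
        omega
      · have hlt : (C \ (C ∩ B)).ncard < n := by
          rw [← hn]
          refine Set.ncard_lt_ncard ⟨?_, ?_⟩ (hC.subset Set.sdiff_subset)
          · exact fun x hx => ⟨hx.1, fun h => hx.2 ⟨hx.1, hDB.1 h⟩⟩
          · intro hh
            obtain ⟨x, hx, hxD⟩ := Set.not_subset.1 hBD
            exact (hh ⟨hx.1, hxD⟩).2 hx
        have := ih _ hlt (D := C ∩ B) (fun x hx => ⟨hDC (hZD hx), hDB.1 (hZD hx)⟩)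
          Set.inter_subset_left rfl
        omega

end basics

section aclpart

variable {L}
variable {N : Type} [L.Structure N]

lemma copy_subset [Finite (Σ n, L.Relations n)] {Z C : Set N} (hC : C.Finite)
    (hCs : SelfSuffM L C) (hZC : Z ⊆ C)
    (hmin : ∀ W, SelfSuffM L W → Z ⊆ W → C ⊆ W) (h : C → N) (hinj : Function.Injective h)
    (hfix : ∀ z (hz : z ∈ Z), h ⟨z, hZC hz⟩ = z)
    (hrel : ∀ n (R : L.Relations n) (t : Fin n → C),
      Language.Structure.RelMap R (fun i => (t i : N)) →
      Language.Structure.RelMap R (fun i => h (t i))) (w : C) : h w ∈ C := by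
  classical
  by_contra hw
  have : Finite C := hC
  let D : Set N := {x | ∃ hx : x ∈ C, h ⟨x, hx⟩ ∈ C}
  have hDC : D ⊆ C := fun x hx => hx.1
  have hZD : Z ⊆ D := fun z hz => ⟨hZC hz, by rw [hfix z hz]; exact hZC hz⟩
  have hle := cl_min hC hCs hmin hZD hDC
  let C1 : Set N := Set.range h
  have hC1 : C1.Finite := Set.finite_range h
  have hlt : delta L C < delta L (C ∪ C1) :=
    ss_lt hCs (hC.union hC1) ⟨Set.subset_union_left, fun hh => hw (hh (Or.inr ⟨w, rfl⟩))⟩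
  -- cardinalities of points
  have hp1 : D.ncard + (C \ D).ncard = C.ncard := by
    rw [add_comm]; exact Set.ncard_sdiff_add_ncard_of_subset hDC hC
  have hp2 : (C ∪ C1).ncard ≤ C.ncard + (C \ D).ncard := by
    have e : C ∪ C1 ⊆ C ∪ (fun x => if hx : x ∈ C then h ⟨x, hx⟩ else x) '' (C \ D) := by
      rintro x (hx | ⟨y, rfl⟩)
      · exact Or.inl hx
      · by_cases hy : h y ∈ C
        · exact Or.inl hy
        · refine Or.inr ⟨y, ⟨y.2, fun hh => hy hh.2⟩, ?_⟩
          simp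
    have hfin := (hC.subset (Set.sdiff_subset : C \ D ⊆ C))
    refine (Set.ncard_le_ncard e (hC.union (hfin.image _))).trans ?_
    refine (Set.ncard_union_le _ _).trans ?_
    exact Nat.add_le_add_left (Set.ncard_image_le hfin) _
  -- relations
  have hr1 : (relSet L D).ncard + (relSet L C \ relSet L D).ncard = (relSet L C).ncard := by
    rw [add_comm]
    exact Set.ncard_sdiff_add_ncard_of_subset (relSet_mono hDC) (relSet_finite hC)
  let h' : N → N := fun x => if hx : x ∈ C then h ⟨x, hx⟩ else x
  have hh' : ∀ x (hx : x ∈ C), h' x = h ⟨x, hx⟩ := fun x hx => by simp [h', hx]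
  let F : (Σ n, L.Relations n × (Fin n → N)) → (Σ n, L.Relations n × (Fin n → N)) :=
    fun p => ⟨p.1, p.2.1, fun i => h' (p.2.2 i)⟩
  have hFinj : Set.InjOn F (relSet L C \ relSet L D) := by
    rintro ⟨n, R, s⟩ hs ⟨m, S, t⟩ ht hst
    simp only [F, Sigma.mk.injEq] at hst
    obtain ⟨rfl, hst⟩ := hst
    simp only [heq_eq_eq, Prod.mk.injEq] at hst
    obtain ⟨rfl, hst⟩ := hst
    have : s = t := by
      funext i
      have := congrFun hst i
      rw [hh' _ (hs.1.1 i), hh' _ (ht.1.1 i)] at this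
      exact congrArg Subtype.val (hinj this)
    rw [this]
  have hr2 : (relSet L C).ncard + (relSet L C \ relSet L D).ncard
      ≤ (relSet L (C ∪ C1)).ncard := by
    rw [← Set.InjOn.ncard_image hFinj, ← Set.ncard_union_eq _ (relSet_finite hC)
      (((relSet_finite hC).subset Set.sdiff_subset).image _)]
    · refine Set.ncard_le_ncard ?_ (relSet_finite (hC.union hC1))
      rintro p (hp | ⟨⟨n, R, s⟩, hs, rfl⟩)
      · exact relSet_mono Set.subset_union_left hp
      · refine ⟨fun i => Or.inr ?_, ?_⟩
        · change h' (s i) ∈ C1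
          rw [hh' _ (hs.1.1 i)]
          exact ⟨_, rfl⟩
        · have := hrel n R (fun i => ⟨s i, hs.1.1 i⟩) hs.1.2
          have e : (fun i => h' (s i)) = fun i => h ⟨s i, hs.1.1 i⟩ :=
            funext fun i => hh' _ (hs.1.1 i)
          change Language.Structure.RelMap R (fun i => h' (s i))
          rw [e]; exact this
    · rw [Set.disjoint_left]
      rintro p hp ⟨⟨n, R, s⟩, hs, rfl⟩
      apply hs.2
      refine ⟨fun i => ⟨hs.1.1 i, ?_⟩, hs.1.2⟩
      have := hp.1 i
      change h' (s i) ∈ C at this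
      rwa [hh' _ (hs.1.1 i)] at this
  simp only [delta_eq] at hlt hle
  omega

lemma definable_rel {α : Type} (Z : Set N) {n : ℕ} (R : L.Relations n) (t : Fin n → α) :
    Z.Definable L {h : α → N | Language.Structure.RelMap R (fun i => h (t i))} := by
  refine Set.Definable.mono (A := ∅) ?_ (Set.empty_subset _)
  rw [Set.empty_definable_iff]
  refine ⟨Language.Relations.formula R (fun i => Language.Term.var (t i)), ?_⟩
  ext h
  simp [Language.Formula.realize_rel]

lemma definable_eq {α : Type} (Z : Set N) (i j : α) :
    Z.Definable L {h : α → N | h i = h j} := by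
  refine Set.Definable.mono (A := ∅) ?_ (Set.empty_subset _)
  rw [Set.empty_definable_iff]
  refine ⟨Language.Term.equal (Language.Term.var i) (Language.Term.var j), ?_⟩
  ext h
  simp [Language.Formula.realize_equal]

lemma definable_const {α : Type} {Z : Set N} (i : α) {z : N} (hz : z ∈ Z) :
    Z.Definable L {h : α → N | h i = z} := by
  refine ⟨Language.Term.equal (Language.Term.var i)
    (Language.Constants.term (L.con (⟨z, hz⟩ : Z))), ?_⟩
  ext h
  simp [Language.Formula.realize_equal]

lemma cl_sub_acl [Finite (Σ n, L.Relations n)] {Z C : Set N} (hC : C.Finite)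
    (hCs : SelfSuffM L C) (hZC : Z ⊆ C)
    (hmin : ∀ W, SelfSuffM L W → Z ⊆ W → C ⊆ W) {w : N} (hw : w ∈ C) : inAcl L Z w := by
  have : Finite C := hC
  have : Finite Z := hC.subset hZC
  let S : Set (C → N) :=
    (⋂ p : {p : C × C // p.1 ≠ p.2}, {h : C → N | h p.1.1 = h p.1.2}ᶜ) ∩
    ((⋂ z : Z, {h : C → N | h ⟨z, hZC z.2⟩ = z}) ∩
    (⋂ p : {p : Σ q : (Σ n, L.Relations n), (Fin q.1 → C) //
      Language.Structure.RelMap p.1.2 (fun i => (p.2 i : N))},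
      {h : C → N | Language.Structure.RelMap p.1.1.2 (fun i => h (p.1.2 i))}))
  have hS : Z.Definable L S := by
    refine (Set.definable_iInter_of_finite fun p => (definable_eq Z _ _).compl).inter
      ((Set.definable_iInter_of_finite fun z => definable_const _ z.2).inter
      (Set.definable_iInter_of_finite fun p => definable_rel Z _ _))
  have hS' := hS.image_comp (fun _ : Fin 1 => (⟨w, hw⟩ : C))
  refine ⟨(fun h : C → N => h ⟨w, hw⟩) '' S, ?_, ?_, ?_⟩
  · refine ⟨fun x => x, ⟨?_, ?_, ?_⟩, rfl⟩
    · simp only [Set.mem_iInter]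
      intro p hp
      exact p.2 (Subtype.ext hp)
    · simp only [Set.mem_iInter]
      intro z
      rfl
    · simp only [Set.mem_iInter]
      intro p
      exact p.2
  · refine hC.subset ?_
    rintro _ ⟨h, ⟨h1, h2, h3⟩, rfl⟩
    simp only [Set.mem_iInter] at h1 h2 h3
    refine copy_subset hC hCs hZC hmin h ?_ ?_ ?_ _
    · intro x y hxy
      by_contra hne
      exact h1 ⟨(x, y), hne⟩ hxy
    · intro z hz
      exact h2 ⟨z, hz⟩
    · intro n R t ht
      exact h3 ⟨⟨⟨n, R⟩, t⟩, ht⟩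
  · convert hS'
    ext x
    simp only [toDef1, Set.mem_image]
    constructor
    · rintro ⟨h, hh, e⟩
      refine ⟨h, hh, ?_⟩
      funext i
      rw [Subsingleton.elim i 0]
      exact e
    · rintro ⟨h, hh, rfl⟩
      exact ⟨h, hh, rfl⟩

end aclpart

section ext

variable {L}
variable {N : Type} [L.Structure N]

lemma generic_cover [L.IsRelational] {f : ℝ → ℝ} (hgen : IsGeneric L (N := N) f) {X : Set N}
    (hX : X.Finite) : ∃ C : Set N, C.Finite ∧ SelfSuffM L C ∧ X ⊆ C := by
  obtain ⟨⟨c, hm, hfin, hss, -, hU⟩, -⟩ := hgen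
  have : ∃ k, X ⊆ c k := by
    induction X, hX using Set.Finite.induction_on with
    | empty => exact ⟨0, Set.empty_subset _⟩
    | @insert x s _ _ ih =>
      obtain ⟨k, hk⟩ := ih
      have hx : x ∈ ⋃ k, c k := hU ▸ Set.mem_univ x
      obtain ⟨l, hl⟩ := Set.mem_iUnion.1 hx
      exact ⟨max k l, Set.insert_subset (hm (le_max_right _ _) hl)
        (hk.trans (hm (le_max_left _ _)))⟩
  obtain ⟨k, hk⟩ := this
  exact ⟨c k, hfin k, hss k, hk⟩

lemma generic_kf [L.IsRelational] {f : ℝ → ℝ} (hgen : IsGeneric L (N := N) f) {X : Set N}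
    (hX : X.Finite) : f X.ncard ≤ (delta L X : ℝ) := by
  obtain ⟨⟨c, hm, hfin, hss, hK, hU⟩, -⟩ := hgen
  have : ∃ k, X ⊆ c k := by
    induction X, hX using Set.Finite.induction_on with
    | empty => exact ⟨0, Set.empty_subset _⟩
    | @insert x s _ _ ih =>
      obtain ⟨k, hk⟩ := ih
      have hx : x ∈ ⋃ k, c k := hU ▸ Set.mem_univ x
      obtain ⟨l, hl⟩ := Set.mem_iUnion.1 hx
      exact ⟨max k l, Set.insert_subset (hm (le_max_right _ _) hl)
        (hk.trans (hm (le_max_left _ _)))⟩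
  obtain ⟨k, hk⟩ := this
  exact hK k X hk

/-- Embedding-style extension property. -/
lemma generic_ext [L.IsRelational] {f : ℝ → ℝ} (hgen : IsGeneric L (N := N) f)
    {P E : Type} [L.Structure P] [Finite P] [L.Structure E] [Finite E]
    (q : P ↪[L] N) (hq : SelfSuffM L (Set.range q)) (j : P ↪[L] E)
    (hE : InKf L f E) (hj : SelfSuffIn L (Set.range j) (Set.univ : Set E)) :
    ∃ g : E ↪[L] N, (∀ x, g (j x) = q x) ∧ SelfSuffM L (Set.range g) := by
  classical
  have : Fintype E := Fintype.ofFinite E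
  have hinv : ∀ y : ↥(relSub L (Set.range q)), ∃ x : P, q x = y := fun y => y.2
  choose s hs using hinv
  let e : ↥(relSub L (Set.range q)) ↪[L] E :=
    { toFun := fun y => j (s y)
      inj' := by
        intro x y h
        have := j.injective h
        apply Subtype.ext
        rw [← hs x, ← hs y, this]
      map_fun' := fun {_} f => isEmptyElim f
      map_rel' := by
        intro n R x
        change Language.Structure.RelMap R (j ∘ (fun i => s (x i))) ↔ _
        rw [j.map_rel, ← q.map_rel]
        have e : q ∘ (fun i => s (x i)) = fun i => (x i : N) := funext fun i => hs _
        rw [e]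
        exact ((relSub L (Set.range q)).subtype.map_rel R x) }
  have her : Set.range e = Set.range j := by
    ext z
    constructor
    · rintro ⟨y, rfl⟩; exact ⟨s y, rfl⟩
    · rintro ⟨x, rfl⟩
      refine ⟨⟨q x, x, rfl⟩, ?_⟩
      exact congrArg j (q.injective (hs ⟨q x, x, rfl⟩))
  obtain ⟨g, hg1, hg2⟩ := hgen.2 (Set.range q) (Set.finite_range q) hq E inferInstance
    inferInstance hE e (by rw [her]; exact hj)
  refine ⟨g, fun x => ?_, hg2⟩
  have := hg1 ⟨q x, x, rfl⟩
  have e3 : e ⟨q x, x, rfl⟩ = j x := congrArg j (q.injective (hs ⟨q x, x, rfl⟩))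
  rw [e3] at this
  exact this

lemma delta_sub [L.IsRelational] (D : Set N) (X : Set ↥(relSub L D)) :
    delta L X = delta L ((fun x : ↥(relSub L D) => (x : N)) '' X) :=
  (delta_image (relSub L D).subtype X).symm

lemma inKf_sub [L.IsRelational] {f : ℝ → ℝ} (hgen : IsGeneric L (N := N) f) (D : Set N) :
    InKf L f ↥(relSub L D) := by
  intro X hX
  rw [delta_sub, ← Set.ncard_image_of_injective X Subtype.val_injective]
  exact generic_kf hgen (hX.image _)

lemma generic_bf [L.IsRelational] {f : ℝ → ℝ} (hgen : IsGeneric L (N := N) f)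
    {P : Type} [L.Structure P] [Finite P]
    (p q : P ↪[L] N) (hp : SelfSuffM L (Set.range p)) (hq : SelfSuffM L (Set.range q)) (d : N) :
    ∃ D : Set N, D.Finite ∧ ∃ (j : P ↪[L] ↥(relSub L D)) (p2 q2 : ↥(relSub L D) ↪[L] N),
      SelfSuffM L (Set.range p2) ∧ SelfSuffM L (Set.range q2) ∧
      (∀ x, p2 (j x) = p x) ∧ (∀ x, q2 (j x) = q x) ∧ d ∈ Set.range p2 := by
  obtain ⟨D, hDf, hDs, hD⟩ := generic_cover hgen ((Set.finite_range p).insert d)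
  have : Finite ↥(relSub L D) := hDf
  let j : P ↪[L] ↥(relSub L D) :=
    { toFun := fun x => ⟨p x, hD (Or.inr ⟨x, rfl⟩)⟩
      inj' := fun x y h => p.injective (congrArg Subtype.val h)
      map_fun' := fun {_} f => isEmptyElim f
      map_rel' := fun {n} R x => p.map_rel R x }
  have hj : SelfSuffIn L (Set.range j) (Set.univ : Set ↥(relSub L D)) := by
    refine ⟨Set.subset_univ _, fun B hB _ hBf => ?_⟩
    rw [delta_sub, delta_sub]
    have e : (fun x : ↥(relSub L D) => (x : N)) '' Set.range j = Set.range p := by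
      rw [← Set.range_comp]; rfl
    rw [e]
    refine ss_lt hp (hBf.image _) ?_
    rw [← e]
    exact Function.Injective.image_strictMono Subtype.val_injective hB
  obtain ⟨q2, h1, h2⟩ := generic_ext hgen q hq j (inKf_sub hgen D) hj
  refine ⟨D, hDf, j, (relSub L D).subtype, q2, ?_, h2, fun x => rfl, h1,
    ⟨⟨d, hD (Set.mem_insert _ _)⟩, rfl⟩⟩
  have : Set.range (relSub L D).subtype = D := Subtype.range_coe
  rw [this]; exact hDs

lemma term_var [L.IsRelational] {α : Type} (t : L.Term α) : ∃ i, t = Language.Term.var i := by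
  cases t with
  | var i => exact ⟨i, rfl⟩
  | func F ts => exact isEmptyElim F

lemma bf_realize [L.IsRelational] {f : ℝ → ℝ} (hgen : IsGeneric L (N := N) f)
    {α : Type} {n : ℕ} (φ : L.BoundedFormula α n) :
    ∀ (P : Type) (_ : L.Structure P) (_ : Finite P) (p q : P ↪[L] N),
      SelfSuffM L (Set.range p) → SelfSuffM L (Set.range q) →
      ∀ (v : α → P) (xs : Fin n → P), φ.Realize (p ∘ v) (p ∘ xs) ↔ φ.Realize (q ∘ v) (q ∘ xs) := by
  induction φ with
  | falsum => intros; rfl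
  | equal t₁ t₂ =>
    intro P _ _ p q hp hq v xs
    obtain ⟨i, rfl⟩ := term_var t₁
    obtain ⟨j, rfl⟩ := term_var t₂
    simp only [Language.BoundedFormula.Realize, Language.Term.realize_var, ← Sum.comp_elim,
      Function.comp_apply, p.injective.eq_iff, q.injective.eq_iff]
  | rel R ts =>
    intro P _ _ p q hp hq v xs
    choose i hi using fun k => term_var (ts k)
    simp only [Language.BoundedFormula.Realize, hi, Language.Term.realize_var, ← Sum.comp_elim]
    exact (p.map_rel R (fun k => Sum.elim v xs (i k))).trans
      (q.map_rel R (fun k => Sum.elim v xs (i k))).symm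
  | imp f₁ f₂ ih1 ih2 =>
    intro P _ _ p q hp hq v xs
    simp only [Language.BoundedFormula.realize_imp]
    rw [ih1 P _ ‹_› p q hp hq, ih2 P _ ‹_› p q hp hq]
  | all φ ih =>
    have key : ∀ (P : Type) (_ : L.Structure P) (_ : Finite P) (p q : P ↪[L] N),
      SelfSuffM L (Set.range p) → SelfSuffM L (Set.range q) →
      ∀ (v : α → P) (xs : Fin _ → P), φ.all.Realize (p ∘ v) (p ∘ xs) →
        φ.all.Realize (q ∘ v) (q ∘ xs) := by
      intro P _ _ p q hp hq v xs h
      rw [Language.BoundedFormula.realize_all] at h ⊢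
      intro d
      obtain ⟨D, hDf, j, p2, q2, hp2, hq2, e1, e2, ⟨d', hd'⟩⟩ := generic_bf hgen q p hq hp d
      have : Finite ↥(relSub L D) := hDf
      have := h (q2 d')
      have E1 : q ∘ v = p2 ∘ (j ∘ v) := funext fun i => (e1 _).symm
      have E2 : p ∘ v = q2 ∘ (j ∘ v) := funext fun i => (e2 _).symm
      have E3 : Fin.snoc (q ∘ xs) d = p2 ∘ (Fin.snoc (j ∘ xs) d' : Fin _ → ↥(relSub L D)) := by
        rw [Fin.comp_snoc, hd']; congr 1; exact funext fun i => (e1 _).symm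
      have E4 : Fin.snoc (p ∘ xs) (q2 d') =
          q2 ∘ (Fin.snoc (j ∘ xs) d' : Fin _ → ↥(relSub L D)) := by
        rw [Fin.comp_snoc]; congr 1; exact funext fun i => (e2 _).symm
      rw [E2, E4] at this
      rw [E1, E3]
      exact (ih _ _ ‹_› q2 p2 hq2 hp2 _ _).1 this
    intro P i1 i2 p q hp hq v xs
    exact ⟨key P i1 i2 p q hp hq v xs, key P i1 i2 q p hq hp v xs⟩

end ext

section arith

lemma good_step {f g : ℝ → ℝ} (hf : IsGoodFun f g)
    (hg : ∀ x ∈ Set.Ici (0 : ℝ), g x ≤ 1 / (2 * (x + 1))) (u v : ℕ) (h : v ≤ 2 * u + 2) :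
    f ((u + v : ℕ) : ℝ) ≤ f u + 1 := by
  have hu : (0 : ℝ) ≤ u := Nat.cast_nonneg u
  have hv : (0 : ℝ) ≤ v := Nat.cast_nonneg v
  have key := image_le_of_deriv_right_le_deriv_boundary (f := f) (f' := g) (a := u) (b := u + v)
    (hf.cont.mono fun x hx => hu.trans hx.1)
    (fun x hx => hf.rightDeriv x (hu.trans hx.1))
    (B := fun x => f u + (1 / (2 * ((u : ℝ) + 1))) * (x - u))
    (B' := fun _ => 1 / (2 * ((u : ℝ) + 1))) (by simp) (by fun_prop)
    (fun x _ => by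
      have := (((hasDerivAt_id x).sub_const (u : ℝ)).const_mul (1 / (2 * ((u : ℝ) + 1)))).const_add
        (f u)
      simpa using this.hasDerivWithinAt)
    (fun x hx => by
      refine (hg x (hu.trans hx.1)).trans ?_
      have := hx.1
      gcongr)
    (x := u + v) ⟨by linarith, le_rfl⟩
  push_cast
  refine key.trans ?_
  have h' : (v : ℝ) ≤ 2 * u + 2 := by exact_mod_cast h
  have : 1 / (2 * ((u : ℝ) + 1)) * ((u : ℝ) + v - u) ≤ 1 := by
    rw [one_div_mul_eq_div, div_le_one (by positivity)]
    linarith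
  linarith

lemma amalg2 {f : ℝ → ℝ} (hf : ∀ u v : ℕ, v ≤ 2 * u + 2 → f ((u + v : ℕ) : ℝ) ≤ f u + 1)
    (a b c : ℕ) (d x y : ℤ) (hb : f ((a + b : ℕ) : ℝ) ≤ (d + x : ℤ))
    (hc : f ((a + c : ℕ) : ℝ) ≤ (d + y : ℤ))
    (hx : (b = 0 ∧ x = 0) ∨ 1 ≤ x) (hy : (c = 0 ∧ y = 0) ∨ 1 ≤ y) :
    f ((a + b + c : ℕ) : ℝ) ≤ (d + x + y : ℤ) := by
  rcases hx with ⟨rfl, rfl⟩ | hx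
  · simpa using hc
  rcases hy with ⟨rfl, rfl⟩ | hy
  · simpa using hb
  have hx' : (1 : ℝ) ≤ x := by exact_mod_cast hx
  have hy' : (1 : ℝ) ≤ y := by exact_mod_cast hy
  push_cast at hb hc ⊢
  by_cases h : b ≤ c
  · have := hf (a + c) b (by omega)
    have e : a + c + b = a + b + c := by omega
    rw [e] at this
    push_cast at this
    linarith
  · have := hf (a + b) c (by omega)
    push_cast at this
    linarith

lemma amalgS {f : ℝ → ℝ} (hf : ∀ u v : ℕ, v ≤ 2 * u + 2 → f ((u + v : ℕ) : ℝ) ≤ f u + 1)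
    {I : Type} (a : ℕ) (d : ℤ) (β : I → ℕ) (δ : I → ℤ) (ha : f (a : ℝ) ≤ d)
    (hB : ∀ i, f ((a + β i : ℕ) : ℝ) ≤ (d + δ i : ℤ))
    (hδ : ∀ i, (β i = 0 ∧ δ i = 0) ∨ 1 ≤ δ i) (S : Finset I) :
    f ((a + ∑ i ∈ S, β i : ℕ) : ℝ) ≤ (d + ∑ i ∈ S, δ i : ℤ) ∧
      ((∑ i ∈ S, β i = 0 ∧ ∑ i ∈ S, δ i = 0) ∨ 1 ≤ ∑ i ∈ S, δ i) := by
  classical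
  induction S using Finset.induction_on with
  | empty => simpa using ha
  | insert i S hi ih =>
    rw [Finset.sum_insert hi, Finset.sum_insert hi]
    constructor
    · have := amalg2 hf a (β i) (∑ i ∈ S, β i) d (δ i) (∑ i ∈ S, δ i) (hB i) ih.1 (hδ i) ih.2
      rwa [add_assoc, add_assoc] at this
    · have := hδ i
      omega

lemma arith_main {f : ℝ → ℝ}
    (hf : ∀ u v : ℕ, v ≤ 2 * u + 2 → f ((u + v : ℕ) : ℝ) ≤ f u + 1)
    {I : Type} [Fintype I] (a c : ℕ) (d γ e : ℤ) (β : I → ℕ) (δ : I → ℤ) (ha : f (a : ℝ) ≤ d)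
    (hB : ∀ i, f ((a + β i : ℕ) : ℝ) ≤ (d + δ i : ℤ))
    (hδ : ∀ i, (β i = 0 ∧ δ i = 0) ∨ 1 ≤ δ i)
    (hC : f ((a + c : ℕ) : ℝ) ≤ (d + γ : ℤ)) (hγ : (c = 0 ∧ γ = 0) ∨ 1 ≤ γ)
    (he : e ≤ γ) (he0 : 0 ≤ e)
    (hT : e = 0 ∨ e + 1 ≤ ((Finset.univ.filter fun i => 1 ≤ δ i).card : ℤ)) :
    f ((a + (c + ∑ i, β i) : ℕ) : ℝ) ≤ (d + (γ + ∑ i, δ i) - e : ℤ) := by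
  classical
  by_cases h0 : e = 0
  · subst h0
    have hS := amalgS hf a d β δ ha hB hδ Finset.univ
    have := amalg2 hf a c _ d γ _ hC hS.1 hγ hS.2
    rw [add_assoc, add_assoc] at this
    simpa using this
  have hT := hT.resolve_left h0
  set T := Finset.univ.filter fun i => 1 ≤ δ i with hTdef
  have hTc : 2 ≤ T.card := by omega
  have hbT : ∑ i, β i = ∑ i ∈ T, β i := by
    symm
    apply Finset.sum_subset (Finset.subset_univ _)
    intro i _ hi
    have := hδ i
    simp only [hTdef, Finset.mem_filter, Finset.mem_univ, true_and] at hi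
    tauto
  have hdT : ∑ i, δ i = ∑ i ∈ T, δ i := by
    symm
    apply Finset.sum_subset (Finset.subset_univ _)
    intro i _ hi
    have := hδ i
    simp only [hTdef, Finset.mem_filter, Finset.mem_univ, true_and] at hi
    tauto
  obtain ⟨m, hm, hmin⟩ := Finset.exists_min_image T β (Finset.card_pos.1 (by omega))
  have hcard : 1 ≤ (T.erase m).card := by rw [Finset.card_erase_of_mem hm]; omega
  obtain ⟨i, hi⟩ := Finset.card_pos.1 hcard
  have hge : β m ≤ ∑ i ∈ T.erase m, β i :=
    (hmin i (Finset.mem_of_mem_erase hi)).trans (Finset.single_le_sum (fun _ _ => Nat.zero_le _) hi)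
  have hb2 := Finset.add_sum_erase T β hm
  have hd2 := Finset.add_sum_erase T δ hm
  have hδm : 1 ≤ δ m := (Finset.mem_filter.1 hm).2
  have hsumT : (T.card : ℤ) ≤ ∑ i ∈ T, δ i := by
    have := Finset.card_nsmul_le_sum T δ 1 (fun i hi => (Finset.mem_filter.1 hi).2)
    simpa using this
  have hS := (amalgS hf a d β δ ha hB hδ (T.erase m)).1
  rw [hbT, hdT]
  by_cases hc : c ≤ a + ∑ i ∈ T.erase m, β i
  · have := hf (a + ∑ i ∈ T.erase m, β i) (c + β m) (by omega)
    have e1 : a + ∑ i ∈ T.erase m, β i + (c + β m) = a + (c + ∑ i ∈ T, β i) := by omega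
    rw [e1] at this
    refine this.trans ((add_le_add_left hS 1).trans ?_)
    have : d + ∑ i ∈ T.erase m, δ i + 1 ≤ d + (γ + ∑ i ∈ T, δ i) - e := by omega
    exact_mod_cast this
  · have := hf (a + c) (∑ i ∈ T, β i) (by omega)
    have e1 : a + c + ∑ i ∈ T, β i = a + (c + ∑ i ∈ T, β i) := by omega
    rw [e1] at this
    refine this.trans ((add_le_add_left hC 1).trans ?_)
    have : d + γ + 1 ≤ d + (γ + ∑ i ∈ T, δ i) - e := by omega
    exact_mod_cast this

lemma arith_strong {I : Type} [Fintype I] [DecidableEq I] (δ : I → ℤ) (γ e : ℤ)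
    (hnn : ∀ i, 0 ≤ δ i) (hγ : 0 ≤ γ) (he : e ≤ γ)
    (hT : e = 0 ∨ e + 1 ≤ ((Finset.univ.filter fun i => 1 ≤ δ i).card : ℤ)) :
    (∀ i', 1 ≤ δ i' → 0 < ∑ i, δ i - e) ∧
    (∀ i, (1 ≤ γ ∨ ∃ i', i' ≠ i ∧ 1 ≤ δ i') → δ i < γ + ∑ i, δ i - e) := by
  have hsumT : ((Finset.univ.filter fun i => 1 ≤ δ i).card : ℤ) ≤ ∑ i, δ i := by
    have h1 := Finset.card_nsmul_le_sum (Finset.univ.filter fun i => 1 ≤ δ i) δ 1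
      (fun i hi => (Finset.mem_filter.1 hi).2)
    have h2 : ∑ i ∈ (Finset.univ.filter fun i => 1 ≤ δ i), δ i ≤ ∑ i, δ i :=
      Finset.sum_le_sum_of_subset_of_nonneg (Finset.subset_univ _) fun i _ _ => hnn _
    simp only [nsmul_eq_mul, mul_one] at h1
    exact h1.trans h2
  constructor
  · intro i' h1
    have : δ i' ≤ ∑ i, δ i := Finset.single_le_sum (fun i _ => hnn _) (Finset.mem_univ i')
    omega
  · intro i h
    have hsplit : δ i + ∑ x ∈ Finset.univ.erase i, δ x = ∑ x, δ x :=
      Finset.add_sum_erase Finset.univ δ (Finset.mem_univ i)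
    have hrest : 0 ≤ ∑ x ∈ Finset.univ.erase i, δ x := Finset.sum_nonneg fun i _ => hnn _
    have hT' : ((Finset.univ.filter fun i => 1 ≤ δ i).card : ℤ) - 1 ≤
        ∑ x ∈ Finset.univ.erase i, δ x := by
      have h1 := Finset.card_nsmul_le_sum ((Finset.univ.filter fun i => 1 ≤ δ i).erase i) δ 1
        (fun i hi => (Finset.mem_filter.1 (Finset.mem_of_mem_erase hi)).2)
      have h2 : ∑ x ∈ ((Finset.univ.filter fun i => 1 ≤ δ i).erase i), δ x ≤
          ∑ x ∈ Finset.univ.erase i, δ x :=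
        Finset.sum_le_sum_of_subset_of_nonneg (Finset.erase_subset_erase _ (Finset.subset_univ _))
          fun i _ _ => hnn _
      have h3 := Finset.pred_card_le_card_erase (s := Finset.univ.filter fun i => 1 ≤ δ i) (a := i)
      simp only [nsmul_eq_mul, mul_one] at h1
      have h4 := h1.trans h2
      omega
    rcases h with h | ⟨i', hne, h⟩
    · omega
    · have hi' : i' ∈ Finset.univ.erase i := Finset.mem_erase.2 ⟨hne, Finset.mem_univ _⟩
      have : δ i' ≤ ∑ x ∈ Finset.univ.erase i, δ x :=
        Finset.single_le_sum (fun i _ => hnn _) hi'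
      omega

end arith

section amalgam

/-- Underlying set of the free amalgam of the `D j` over `A`. -/
def AmT {N J : Type} (A : Set N) (D : J → Set N) : Type :=
  {p : Option J × N // (p.1 = none ∧ p.2 ∈ A) ∨ ∃ j, p.1 = some j ∧ p.2 ∈ D j ∧ p.2 ∉ A}

variable {N J : Type} {A : Set N} {D : J → Set N}

/-- label -/
def AmT.lab (e : AmT A D) : Option J := e.1.1

/-- projection -/
def AmT.pr (e : AmT A D) : N := e.1.2

lemma AmT.ext' {e e' : AmT A D} (h1 : e.lab = e'.lab) (h2 : e.pr = e'.pr) : e = e' :=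
  Subtype.ext (Prod.ext h1 h2)

lemma AmT.lab_none {e : AmT A D} : e.lab = none ↔ e.pr ∈ A := by
  obtain ⟨⟨o, x⟩, h⟩ := e
  simp only [AmT.lab, AmT.pr]
  rcases h with ⟨h1, h2⟩ | ⟨j, h1, h2, h3⟩
  · simp only at h1 h2; simp [h1, h2]
  · simp only at h1 h2 h3; simp [h1, h3]

lemma AmT.mem_of_some {e : AmT A D} {j : J} (h : e.lab = some j) : e.pr ∈ D j := by
  obtain ⟨⟨o, x⟩, h'⟩ := e
  simp only [AmT.lab, AmT.pr] at h ⊢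
  rcases h' with ⟨h1, h2⟩ | ⟨j', h1, h2, h3⟩
  · simp_all
  · simp only at h1 h2
    rw [h] at h1
    obtain rfl := Option.some.inj h1
    exact h2

/-- being in the piece `j` -/
def AmT.inP (e : AmT A D) (j : J) : Prop := e.lab = none ∨ e.lab = some j

lemma AmT.inP_inj {e e' : AmT A D} {j : J} (h : e.inP j) (h' : e'.inP j) (hp : e.pr = e'.pr) :
    e = e' := by
  refine AmT.ext' ?_ hp
  have : e.lab = none ↔ e'.lab = none := by rw [AmT.lab_none, AmT.lab_none, hp]
  rcases h with h | h <;> rcases h' with h' | h' <;> simp_all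

open Classical in
/-- inclusion of the piece `j` -/
noncomputable def AmT.inc (j : J) (x : D j) : AmT A D :=
  ⟨(if (x : N) ∈ A then none else some j, x), by
    by_cases h : (x : N) ∈ A
    · simp [h]
    · simp [h, x.2]⟩

lemma AmT.inc_pr (j : J) (x : D j) : (AmT.inc (A := A) j x).pr = x := rfl

lemma AmT.inc_inP (j : J) (x : D j) : (AmT.inc (A := A) j x).inP j := by
  by_cases h : (x : N) ∈ A
  · left; simp [AmT.inc, AmT.lab, h]
  · right; simp [AmT.inc, AmT.lab, h]

lemma AmT.inc_lab (j : J) (x : D j) (h : (x : N) ∉ A) :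
    (AmT.inc (A := A) j x).lab = some j := by
  simp [AmT.inc, AmT.lab, h]

lemma AmT.inc_surj (hA : ∀ j, A ⊆ D j) {j : J} {e : AmT A D} (h : e.inP j) :
    ∃ x : D j, AmT.inc j x = e := by
  have : e.pr ∈ D j := by
    rcases h with h | h
    · exact hA j (AmT.lab_none.1 h)
    · exact AmT.mem_of_some h
  exact ⟨⟨e.pr, this⟩, AmT.inP_inj (AmT.inc_inP j _) h rfl⟩

instance [Finite J] [Finite A] [∀ j, Finite (D j)] : Finite (AmT A D) := by
  let F : AmT A D → Option J × ↥(A ∪ ⋃ j, D j) := fun e => (e.lab, ⟨e.pr, by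
    rcases h : e.lab with _ | j
    · exact Or.inl (AmT.lab_none.1 h)
    · exact Or.inr (Set.mem_iUnion.2 ⟨j, AmT.mem_of_some h⟩)⟩)
  have : Finite ↥(A ∪ ⋃ j, D j) :=
    (Set.Finite.union (Set.toFinite A) (Set.finite_iUnion fun j => Set.toFinite (D j)))
  refine Finite.of_injective F fun e e' h => ?_
  simp only [F, Prod.mk.injEq, Subtype.mk.injEq] at h
  exact AmT.ext' h.1 h.2

/-- trace of `X` on the base -/
def pa (X : Set (AmT A D)) : Set N := AmT.pr '' {e | e ∈ X ∧ e.lab = none}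

/-- trace of `X` on the piece `j` -/
def pc (X : Set (AmT A D)) (j : J) : Set N := AmT.pr '' {e | e ∈ X ∧ e.inP j}

lemma pa_sub_pc (X : Set (AmT A D)) (j : J) : pa X ⊆ pc X j :=
  Set.image_mono fun _ he => ⟨he.1, Or.inl he.2⟩

lemma pa_sub (X : Set (AmT A D)) : pa X ⊆ A := by
  rintro _ ⟨e, he, rfl⟩
  exact AmT.lab_none.1 he.2

lemma pc_inter (X : Set (AmT A D)) (j : J) : A ∩ pc X j = pa X := by
  ext x
  constructor
  · rintro ⟨hx, e, ⟨he, _⟩, rfl⟩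
    exact ⟨e, ⟨he, AmT.lab_none.2 hx⟩, rfl⟩
  · intro hx
    exact ⟨pa_sub X hx, pa_sub_pc X j hx⟩

lemma pc_sub (hA : ∀ j, A ⊆ D j) (X : Set (AmT A D)) (j : J) : pc X j ⊆ D j := by
  rintro _ ⟨e, ⟨_, he⟩, rfl⟩
  obtain ⟨x, rfl⟩ := AmT.inc_surj hA he
  exact x.2

lemma pa_fin {X : Set (AmT A D)} (hX : X.Finite) : (pa X).Finite :=
  (hX.subset fun _ h => h.1).image _

lemma pc_fin {X : Set (AmT A D)} (hX : X.Finite) (j : J) : (pc X j).Finite :=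
  (hX.subset fun _ h => h.1).image _

lemma mem_pc {X : Set (AmT A D)} {j : J} {x : D j} :
    (x : N) ∈ pc X j ↔ AmT.inc j x ∈ X := by
  constructor
  · rintro ⟨e, ⟨he, hp⟩, h⟩
    have : e = AmT.inc j x := AmT.inP_inj hp (AmT.inc_inP j x) h
    rwa [← this]
  · intro h
    exact ⟨_, ⟨h, AmT.inc_inP j x⟩, rfl⟩

lemma card_am [Fintype J] {X : Set (AmT A D)} (hX : X.Finite) :
    X.ncard = (pa X).ncard + ∑ j, (pc X j \ pa X).ncard := by
  classical
  have h0 : (pa X).ncard = {e | e ∈ X ∧ e.lab = none}.ncard := by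
    refine Set.InjOn.ncard_image fun e he e' he' h => AmT.ext' ?_ h
    rw [he.2, he'.2]
  have hj : ∀ j, (pc X j \ pa X).ncard = {e | e ∈ X ∧ e.lab = some j}.ncard := by
    intro j
    have e1 : pc X j \ pa X = AmT.pr '' {e | e ∈ X ∧ e.lab = some j} := by
      ext x
      constructor
      · rintro ⟨⟨e, ⟨he, h | h⟩, rfl⟩, hn⟩
        · exact absurd ⟨e, ⟨he, h⟩, rfl⟩ hn
        · exact ⟨e, ⟨he, h⟩, rfl⟩
      · rintro ⟨e, ⟨he, h⟩, rfl⟩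
        refine ⟨⟨e, ⟨he, Or.inr h⟩, rfl⟩, fun hn => ?_⟩
        have := AmT.lab_none.2 (pa_sub X hn)
        rw [h] at this
        cases this
    rw [e1]
    refine Set.InjOn.ncard_image fun e he e' he' h => AmT.ext' ?_ h
    rw [he.2, he'.2]
  rw [h0]
  simp only [hj]
  rw [← Fintype.sum_option (f := fun o : Option J => {e | e ∈ X ∧ e.lab = o}.ncard)]
  have hc := Finset.card_eq_sum_card_fiberwise (s := hX.toFinset) (t := Finset.univ)
    (f := AmT.lab) (fun _ _ => Finset.mem_univ _)
  rw [Set.ncard_eq_toFinset_card X hX, hc]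
  refine Finset.sum_congr rfl fun o _ => ?_
  rw [← Set.ncard_coe_finset]
  congr 1
  ext e
  simp

variable {L} [L.Structure N] [L.IsRelational]

/-- The structure on the amalgam, with additional relation instances `Ed`. -/
@[reducible] def amStr (Ed : Set (Σ n, L.Relations n × (Fin n → AmT A D))) :
    L.Structure (AmT A D) where
  funMap := fun {_} f => isEmptyElim f
  RelMap := fun {n} R t =>
    ((∃ j, ∀ i, (t i).inP j) ∧ Language.Structure.RelMap R (fun i => (t i).pr)) ∨
      (⟨n, R, t⟩ : Σ n, L.Relations n × (Fin n → AmT A D)) ∈ Ed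

lemma delta_am [Finite (Σ n, L.Relations n)] [Fintype J]
    (Ed : Set (Σ n, L.Relations n × (Fin n → AmT A D))) {X : Set (AmT A D)} (hX : X.Finite) :
    delta L (pa X) + ∑ j, (delta L (pc X j) - delta L (pa X)) -
      ({p | p ∈ Ed ∧ ∀ i, p.2.2 i ∈ X}.ncard : ℤ) ≤
      @delta L (AmT A D) (amStr Ed) X := by
  classical
  letI := amStr (L := L) Ed
  change _ ≤ delta L X
  let F : (Σ n, L.Relations n × (Fin n → AmT A D)) → (Σ n, L.Relations n × (Fin n → N)) :=
    fun p => ⟨p.1, p.2.1, fun i => (p.2.2 i).pr⟩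
  let S0 : Set (Σ n, L.Relations n × (Fin n → AmT A D)) :=
    {p | (∀ i, p.2.2 i ∈ X) ∧ (∀ i, (p.2.2 i).lab = none) ∧ F p ∈ relSet L (Set.univ : Set N)}
  let S : J → Set (Σ n, L.Relations n × (Fin n → AmT A D)) := fun j =>
    {p | (∀ i, p.2.2 i ∈ X) ∧ (∀ i, (p.2.2 i).inP j) ∧ (∃ i, (p.2.2 i).lab ≠ none) ∧
      F p ∈ relSet L (Set.univ : Set N)}
  let E : Set (Σ n, L.Relations n × (Fin n → AmT A D)) := {p | p ∈ Ed ∧ ∀ i, p.2.2 i ∈ X}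
  have htup := tuples_finite (L := L) hX
  have hFinj : ∀ j, Set.InjOn F {p | ∀ i, (p.2.2 i).inP j} := by
    rintro j ⟨n, R, s⟩ hs ⟨m, R', t⟩ ht hst
    simp only [F, Sigma.mk.injEq] at hst
    obtain ⟨rfl, hst⟩ := hst
    simp only [heq_eq_eq, Prod.mk.injEq] at hst
    obtain ⟨rfl, hst⟩ := hst
    have : s = t := funext fun i => AmT.inP_inj (hs i) (ht i) (congrFun hst i)
    rw [this]
  have hcover : relSet L X ⊆ (S0 ∪ ⋃ j, S j) ∪ E := by
    rintro ⟨n, R, t⟩ ⟨h1, h2⟩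
    rcases h2 with ⟨⟨j, hj⟩, h2⟩ | h2
    · left
      by_cases h0 : ∀ i, (t i).lab = none
      · exact Or.inl ⟨h1, h0, fun _ => Set.mem_univ _, h2⟩
      · push Not at h0
        exact Or.inr (Set.mem_iUnion.2 ⟨j, h1, hj, h0, fun _ => Set.mem_univ _, h2⟩)
    · exact Or.inr ⟨h2, h1⟩
  have hS0 : S0.ncard ≤ (relSet L (pa X)).ncard := by
    refine Set.ncard_le_ncard_of_injOn F ?_ ?_ (relSet_finite (pa_fin hX))
    · rintro p ⟨h1, h2, h3⟩
      exact ⟨fun i => ⟨_, ⟨h1 i, h2 i⟩, rfl⟩, h3.2⟩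
    · rintro ⟨n, R, s⟩ hs ⟨m, R', t⟩ ht hst
      simp only [F, Sigma.mk.injEq] at hst
      obtain ⟨rfl, hst⟩ := hst
      simp only [heq_eq_eq, Prod.mk.injEq] at hst
      obtain ⟨rfl, hst⟩ := hst
      have : s = t := funext fun i =>
        AmT.ext' ((hs.2.1 i).trans (ht.2.1 i).symm) (congrFun hst i)
      rw [this]
  have hS : ∀ j, ((S j).ncard : ℤ) ≤ (relSet L (pc X j)).ncard - (relSet L (pa X)).ncard := by
    intro j
    have h1 : (S j).ncard ≤ (relSet L (pc X j) \ relSet L (pa X)).ncard := by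
      refine Set.ncard_le_ncard_of_injOn F ?_ ((hFinj j).mono fun p hp => hp.2.1)
        ((relSet_finite (pc_fin hX j)).subset Set.sdiff_subset)
      rintro p ⟨h1, h2, ⟨i, hi⟩, h3⟩
      refine ⟨⟨fun i => ⟨_, ⟨h1 i, h2 i⟩, rfl⟩, h3.2⟩, fun hh => hi ?_⟩
      exact AmT.lab_none.2 (pa_sub X (hh.1 i))
    have h2 := Set.ncard_sdiff_add_ncard_of_subset (relSet_mono (L := L) (pa_sub_pc X j))
      (relSet_finite (pc_fin hX j))
    omega
  have hU : (⋃ j, S j).ncard ≤ ∑ j, (S j).ncard := Set.ncard_iUnion_le_of_fintype S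
  have hfin : ((S0 ∪ ⋃ j, S j) ∪ E).Finite := by
    refine htup.subset ?_
    rintro p ((h | h) | h)
    · exact h.1
    · obtain ⟨j, hj⟩ := Set.mem_iUnion.1 h
      exact hj.1
    · exact h.2
  have hR : (relSet L X).ncard ≤ S0.ncard + (⋃ j, S j).ncard + E.ncard :=
    (Set.ncard_le_ncard hcover hfin).trans ((Set.ncard_union_le _ _).trans
      (Nat.add_le_add_right (Set.ncard_union_le _ _) _))
  have hsum : (∑ j, ((S j).ncard : ℤ)) ≤
      ∑ j, (((relSet L (pc X j)).ncard : ℤ) - (relSet L (pa X)).ncard) :=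
    Finset.sum_le_sum fun j _ => hS j
  have hpts : ∀ j, ((pc X j \ pa X).ncard : ℤ) = (pc X j).ncard - (pa X).ncard := by
    intro j
    have := Set.ncard_sdiff_add_ncard_of_subset (pa_sub_pc X j) (pc_fin hX j)
    omega
  have hcard := card_am hX
  have hcard' : (X.ncard : ℤ) = (pa X).ncard +
      ∑ j, (((pc X j).ncard : ℤ) - (pa X).ncard) := by
    rw [hcard]; push_cast; simp only [hpts]
  have hU' : ((⋃ j, S j).ncard : ℤ) ≤ ∑ j, ((S j).ncard : ℤ) := by exact_mod_cast hU
  have hexp : ∑ j, (delta L (pc X j) - delta L (pa X)) =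
      ∑ j, (((pc X j).ncard : ℤ) - (pa X).ncard) -
      ∑ j, (((relSet L (pc X j)).ncard : ℤ) - (relSet L (pa X)).ncard) := by
    rw [← Finset.sum_sub_distrib]
    refine Finset.sum_congr rfl fun j _ => ?_
    simp only [delta_eq]; ring
  rw [hexp, delta_eq, delta_eq, hcard']
  change _ - (E.ncard : ℤ) ≤ _
  have hR' : ((relSet L X).ncard : ℤ) ≤ S0.ncard + (⋃ j, S j).ncard + E.ncard := by
    exact_mod_cast hR
  have hS0' : (S0.ncard : ℤ) ≤ (relSet L (pa X)).ncard := by exact_mod_cast hS0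
  linarith

end amalgam

section construction

variable {L}
variable {N : Type} [L.Structure N] [L.IsRelational]

/-- The pieces of the amalgam. -/
@[reducible] def pcs (B C : Set N) (Y : Finset N) : Option (Option ↥Y) → Set N :=
  fun j => Option.elim j C (fun _ => B)

/-- The new triples. -/
noncomputable def edgeT (A : Set N) {B C : Set N} {Y : Finset N} {b : N} (hb : b ∈ B)
    (hY : (Y : Set N) ⊆ C) (y : Y) : Fin 3 → AmT A (pcs B C Y) :=
  ![AmT.inc (some none) ⟨b, hb⟩, AmT.inc (some (some y)) ⟨b, hb⟩, AmT.inc none ⟨y, hY y.2⟩]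

/-- The set of new relation instances. -/
def edgeS (R3 : L.Relations 3) (A : Set N) {B C : Set N} {Y : Finset N} {b : N} (hb : b ∈ B)
    (hY : (Y : Set N) ⊆ C) : Set (Σ n, L.Relations n × (Fin n → AmT A (pcs B C Y))) :=
  Set.range fun y : Y => ⟨3, R3, edgeT A hb hY y⟩

variable {A B C : Set N} {Y : Finset N} {b : N}

/-- The inclusion of a piece as an embedding. -/
noncomputable def incE (R3 : L.Relations 3) (hb : b ∈ B) (hbA : b ∉ A) (hY : (Y : Set N) ⊆ C)
    (j : Option (Option ↥Y)) :
    @Language.Embedding L ↥(relSub L (pcs B C Y j)) (AmT A (pcs B C Y)) _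
      (amStr (edgeS R3 A hb hY)) :=
  letI := amStr (edgeS R3 A hb hY)
  { toFun := fun x => AmT.inc j x
    inj' := fun x y h => Subtype.ext (congrArg AmT.pr h)
    map_fun' := fun {_} f => isEmptyElim f
    map_rel' := by
      intro n R t
      constructor
      · rintro (⟨_, h⟩ | ⟨y, hy⟩)
        · exact h
        · exfalso
          simp only [Sigma.mk.injEq] at hy
          obtain ⟨rfl, hy⟩ := hy
          simp only [heq_eq_eq, Prod.mk.injEq] at hy
          have h0 : AmT.inc (A := A) (D := pcs B C Y) (some none) ⟨b, hb⟩ =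
            AmT.inc (A := A) (D := pcs B C Y) j (t 0) := congrFun hy.2 0
          have h1 : AmT.inc (A := A) (D := pcs B C Y) (some (some y)) ⟨b, hb⟩ =
            AmT.inc (A := A) (D := pcs B C Y) j (t 1) := congrFun hy.2 1
          have l0 := AmT.inc_lab (A := A) (D := pcs B C Y) (some none) ⟨b, hb⟩ hbA
          have l1 := AmT.inc_lab (A := A) (D := pcs B C Y) (some (some y)) ⟨b, hb⟩ hbA
          have m0 := AmT.inc_inP (A := A) (D := pcs B C Y) j (t 0)
          have m1 := AmT.inc_inP (A := A) (D := pcs B C Y) j (t 1)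
          rw [← h0] at m0
          rw [← h1] at m1
          simp only [AmT.inP, l0, l1] at m0 m1
          simp only [reduceCtorEq, false_or, Option.some.injEq] at m0 m1
          rw [← m0] at m1
          simp at m1
      · intro h
        exact Or.inl ⟨⟨j, fun i => AmT.inc_inP j _⟩, h⟩ }

lemma incE_apply (R3 : L.Relations 3) (hb : b ∈ B) (hbA : b ∉ A) (hY : (Y : Set N) ⊆ C)
    (j : Option (Option ↥Y)) (x : ↥(relSub L (pcs B C Y j))) :
    letI := amStr (edgeS R3 A hb hY)
    incE R3 hb hbA hY j x = AmT.inc (A := A) j x := rfl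

lemma dich (hAs : SelfSuffM L A) {J : Type} {D : J → Set N} {X : Set (AmT A D)} (hX : X.Finite)
    (j : J) : ((pc X j \ pa X).ncard = 0 ∧ delta L (pc X j) - delta L (pa X) = 0) ∨
      1 ≤ delta L (pc X j) - delta L (pa X) := by
  by_cases h : pc X j ⊆ A
  · left
    have e : pc X j = pa X := by rw [← pc_inter X j, Set.inter_eq_right.2 h]
    rw [e]; simp
  · right
    have := ss_cut hAs (pc_fin hX j) h
    rw [pc_inter] at this
    omega

lemma nontriv (hAs : SelfSuffM L A) {J : Type} {D : J → Set N} {X : Set (AmT A D)}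
    (hX : X.Finite) (j : J) {x : N} (hx : x ∈ pc X j) (hxA : x ∉ A) :
    1 ≤ delta L (pc X j) - delta L (pa X) := by
  have := ss_cut hAs (pc_fin hX j) (fun h => hxA (h hx))
  rw [pc_inter] at this
  omega

open Classical in
lemma facts [Finite (Σ n, L.Relations n)] (R3 : L.Relations 3) (hAs : SelfSuffM L A)
    (hAB : A ⊆ B) (hAC : A ⊆ C) (hb : b ∈ B) (hbA : b ∉ A) (hY : (Y : Set N) ⊆ C)
    (hYi : ∀ C' : Set N, C' ⊆ C → C'.Finite →
      delta L (A ∩ C') + ((Y : Set N) ∩ C').ncard ≤ delta L C')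
    {X : Set (AmT A (pcs B C Y))} (hX : X.Finite) :
    ∃ e : ℤ, 0 ≤ e ∧ e ≤ delta L (pc X none) - delta L (pa X) ∧
      (e = 0 ∨ e + 1 ≤ ((Finset.univ.filter fun i : Option ↥Y =>
        1 ≤ delta L (pc X (some i)) - delta L (pa X)).card : ℤ)) ∧
      delta L (pa X) + ((delta L (pc X none) - delta L (pa X)) +
        ∑ i : Option ↥Y, (delta L (pc X (some i)) - delta L (pa X))) - e ≤
        @delta L _ (amStr (edgeS R3 A hb hY)) X := by
  have hA : ∀ j, A ⊆ pcs B C Y j := by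
    rintro (_ | j)
    · exact hAC
    · exact hAB
  let Q : Finset ↥Y := Finset.univ.filter fun y => ∀ i, edgeT A hb hY y i ∈ X
  have q0 : ∀ y ∈ Q, b ∈ pc X (some none) := fun y hy =>
    (mem_pc (x := (⟨b, hb⟩ : pcs B C Y (some none)))).2 ((Finset.mem_filter.1 hy).2 0)
  have q1 : ∀ y ∈ Q, b ∈ pc X (some (some y)) := fun y hy =>
    (mem_pc (x := (⟨b, hb⟩ : pcs B C Y (some (some y))))).2 ((Finset.mem_filter.1 hy).2 1)
  have q2 : ∀ y ∈ Q, (y : N) ∈ pc X none := fun y hy =>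
    (mem_pc (x := (⟨y, hY y.2⟩ : pcs B C Y none))).2 ((Finset.mem_filter.1 hy).2 2)
  refine ⟨Q.card, by positivity, ?_, ?_, ?_⟩
  · have h1 := hYi (pc X none) (pc_sub hA X none) (pc_fin hX _)
    rw [pc_inter] at h1
    have h2 : Q.card ≤ ((Y : Set N) ∩ pc X none).ncard := by
      rw [← Set.ncard_coe_finset Q, ← Set.ncard_image_of_injective _ Subtype.val_injective]
      refine Set.ncard_le_ncard ?_ ((pc_fin hX _).subset Set.inter_subset_right)
      rintro _ ⟨y, hy, rfl⟩
      exact ⟨y.2, q2 y hy⟩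
    omega
  · by_cases hQ : Q = ∅
    · left; simp [hQ]
    · right
      obtain ⟨y0, hy0⟩ := Finset.nonempty_iff_ne_empty.2 hQ
      have h1 : insert none (Q.map Function.Embedding.some) ⊆
          (Finset.univ.filter fun i : Option ↥Y =>
          1 ≤ delta L (pc X (some i)) - delta L (pa X)) := by
        intro i hi
        simp only [Finset.mem_filter, Finset.mem_univ, true_and]
        rcases Finset.mem_insert.1 hi with rfl | hi
        · exact nontriv hAs hX _ (q0 y0 hy0) hbA
        · obtain ⟨y, hy, rfl⟩ := Finset.mem_map.1 hi
          exact nontriv hAs hX _ (q1 y hy) hbA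
      have h2 := Finset.card_le_card h1
      rw [Finset.card_insert_of_notMem (by simp), Finset.card_map] at h2
      exact_mod_cast h2
  · have h1 := delta_am (edgeS R3 A hb hY) hX
    rw [Fintype.sum_option] at h1
    have h2 : {p | p ∈ edgeS R3 A hb hY ∧ ∀ i, p.2.2 i ∈ X}.ncard ≤ Q.card := by
      have e : {p | p ∈ edgeS R3 A hb hY ∧ ∀ i, p.2.2 i ∈ X} ⊆
          (fun y : Y => (⟨3, R3, edgeT A hb hY y⟩ :
            Σ n, L.Relations n × (Fin n → AmT A (pcs B C Y)))) '' (Q : Set ↥Y) := by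
        rintro _ ⟨⟨y, rfl⟩, h⟩
        exact ⟨y, by simpa [Q] using h, rfl⟩
      refine (Set.ncard_le_ncard e (Q.finite_toSet.image _)).trans ?_
      refine (Set.ncard_image_le Q.finite_toSet).trans ?_
      rw [Set.ncard_coe_finset]
    have h3 : ({p | p ∈ edgeS R3 A hb hY ∧ ∀ i, p.2.2 i ∈ X}.ncard : ℤ) ≤ Q.card := by
      exact_mod_cast h2
    linarith

lemma am_kf [Finite (Σ n, L.Relations n)] {f g : ℝ → ℝ} (hf : IsGoodFun f g)
    (hg : ∀ x ∈ Set.Ici (0 : ℝ), g x ≤ 1 / (2 * (x + 1)))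
    (hgen : IsGeneric L (N := N) f) (R3 : L.Relations 3) (hAs : SelfSuffM L A)
    (hAB : A ⊆ B) (hAC : A ⊆ C) (hb : b ∈ B) (hbA : b ∉ A) (hY : (Y : Set N) ⊆ C)
    (hYi : ∀ C' : Set N, C' ⊆ C → C'.Finite →
      delta L (A ∩ C') + ((Y : Set N) ∩ C').ncard ≤ delta L C') :
    @InKf L f (AmT A (pcs B C Y)) (amStr (edgeS R3 A hb hY)) := by
  classical
  intro X hX
  obtain ⟨e, he0, he1, he2, he3⟩ := facts R3 hAs hAB hAC hb hbA hY hYi hX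
  have hpc : ∀ j, f (((pa X).ncard + (pc X j \ pa X).ncard : ℕ) : ℝ) ≤
      (delta L (pa X) + (delta L (pc X j) - delta L (pa X)) : ℤ) := by
    intro j
    rw [add_comm (pa X).ncard, Set.ncard_sdiff_add_ncard_of_subset (pa_sub_pc X j) (pc_fin hX j)]
    refine (generic_kf hgen (pc_fin hX j)).trans (le_of_eq ?_)
    congr 1; ring
  have := arith_main (good_step hf hg) (pa X).ncard (pc X none \ pa X).ncard
    (delta L (pa X)) (delta L (pc X none) - delta L (pa X)) e
    (fun i : Option ↥Y => (pc X (some i) \ pa X).ncard)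
    (fun i : Option ↥Y => delta L (pc X (some i)) - delta L (pa X))
    (generic_kf hgen (pa_fin hX)) (fun i => hpc _) (fun i => dich hAs hX _) (hpc _)
    (dich hAs hX _) he1 he0 he2
  rw [card_am hX, Fintype.sum_option]
  refine this.trans ?_
  exact_mod_cast he3

lemma am_strong [Finite (Σ n, L.Relations n)] (R3 : L.Relations 3) (hAs : SelfSuffM L A)
    (hAB : A ⊆ B) (hAC : A ⊆ C) (hb : b ∈ B) (hbA : b ∉ A) (hY : (Y : Set N) ⊆ C)
    (hYi : ∀ C' : Set N, C' ⊆ C → C'.Finite →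
      delta L (A ∩ C') + ((Y : Set N) ∩ C').ncard ≤ delta L C') (j : Option (Option ↥Y)) :
    letI := amStr (edgeS R3 A hb hY)
    SelfSuffIn L (Set.range (incE R3 hb hbA hY j)) (Set.univ : Set (AmT A (pcs B C Y))) := by
  classical
  letI := amStr (edgeS R3 A hb hY)
  refine ⟨Set.subset_univ _, fun X hlt _ hX => ?_⟩
  have hA : ∀ j, A ⊆ pcs B C Y j := by
    rintro (_ | j)
    · exact hAC
    · exact hAB
  obtain ⟨e, he0, he1, he2, he3⟩ := facts R3 hAs hAB hAC hb hbA hY hYi hX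
  have hdel : delta L (Set.range (incE R3 hb hbA hY j)) = delta L (pcs B C Y j) := by
    rw [← Set.image_univ, delta_image, delta_sub]
    congr 1
    rw [Set.image_univ]
    exact Subtype.range_coe
  have hpcj : pc X j = pcs B C Y j := by
    refine Set.Subset.antisymm (pc_sub hA X j) fun x hx => ?_
    exact (mem_pc (x := (⟨x, hx⟩ : pcs B C Y j))).2 (hlt.1 ⟨⟨x, hx⟩, rfl⟩)
  obtain ⟨z, hzX, hz⟩ := Set.not_subset.1 hlt.2
  have hzl : ¬ z.inP j := fun h => by
    obtain ⟨x, rfl⟩ := AmT.inc_surj hA h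
    exact hz ⟨x, rfl⟩
  obtain ⟨j', hj'⟩ : ∃ j', z.lab = some j' := by
    rcases h : z.lab with _ | j'
    · exact absurd (Or.inl h) hzl
    · exact ⟨j', rfl⟩
  have hne : j' ≠ j := fun h => hzl (Or.inr (h ▸ hj'))
  have hzA : z.pr ∉ A := fun h => by
    have := AmT.lab_none.2 h
    rw [hj'] at this; cases this
  have hj1 := nontriv (L := L) hAs hX j' ⟨z, ⟨hzX, Or.inr hj'⟩, rfl⟩ hzA
  rw [hdel, ← hpcj]
  refine lt_of_lt_of_le ?_ he3
  have hnn : ∀ j, 0 ≤ delta L (pc X j) - delta L (pa X) := fun j => by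
    have := dich (L := L) hAs hX j; omega
  have hstr := arith_strong (fun i : Option ↥Y => delta L (pc X (some i)) - delta L (pa X))
    (delta L (pc X none) - delta L (pa X)) e (fun i => hnn _) (hnn _) he1 he2
  rcases j with _ | i
  · obtain ⟨i', rfl⟩ := Option.ne_none_iff_exists'.1 hne
    have := hstr.1 i' hj1
    omega
  · have := hstr.2 i (by
      rcases j' with _ | i'
      · exact Or.inl hj1
      · exact Or.inr ⟨i', fun h => hne (congrArg some h), hj1⟩)
    omega

/-- Choosing a basis. -/
lemma exists_basis [Finite (Σ n, L.Relations n)] {f : ℝ → ℝ} (hgen : IsGeneric L (N := N) f)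
    {Z : Set N} (hAf : A.Finite) (hAs : SelfSuffM L A)
    (hmin : ∀ W, SelfSuffM L W → Z ⊆ W → A ⊆ W) (S : Finset N) :
    ∃ (Y : Finset N) (C : Set N), Y.card ≤ S.card ∧ C.Finite ∧ SelfSuffM L C ∧ A ⊆ C ∧
      (S : Set N) ⊆ C ∧ (Y : Set N) ⊆ C ∧
      (∀ W, SelfSuffM L W → Z ⊆ W → (Y : Set N) ⊆ W → C ⊆ W) ∧
      (∀ C' : Set N, C' ⊆ C → C'.Finite →
        delta L (A ∩ C') + ((Y : Set N) ∩ C').ncard ≤ delta L C') := by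
  classical
  induction S using Finset.induction_on with
  | empty =>
    refine ⟨∅, A, le_rfl, hAf, hAs, subset_rfl, by simp, by simp, fun W h1 h2 _ => hmin W h1 h2,
      fun C' h1 _ => ?_⟩
    rw [Set.inter_eq_right.2 h1]; simp
  | insert y S hy ih =>
    obtain ⟨Y, C, h1, h2, h3, h4, h5, h6, h7, h8⟩ := ih
    by_cases hyC : y ∈ C
    · refine ⟨Y, C, h1.trans (Finset.card_le_card (Finset.subset_insert _ _)), h2, h3, h4, ?_,
        h6, h7, h8⟩
      rw [Finset.coe_insert]
      exact Set.insert_subset hyC h5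
    · obtain ⟨C2, c1, c2, c3, c4⟩ := exists_cl (generic_cover hgen (h2.insert y))
      have hCC : C ⊆ C2 := (Set.subset_insert _ _).trans c3
      refine ⟨insert y Y, C2, ?_, c1, c2, h4.trans hCC, ?_, ?_, ?_, ?_⟩
      · rw [Finset.card_insert_of_notMem hy]
        exact (Finset.card_insert_le _ _).trans (by omega)
      · rw [Finset.coe_insert]
        exact Set.insert_subset (c3 (Set.mem_insert _ _)) (h5.trans hCC)
      · rw [Finset.coe_insert]
        exact Set.insert_subset (c3 (Set.mem_insert _ _)) (h6.trans hCC)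
      · intro W w1 w2 w3
        rw [Finset.coe_insert, Set.insert_subset_iff] at w3
        exact c4 W w1 (Set.insert_subset w3.1 (h7 W w1 w2 w3.2))
      · intro C' d1 d2
        have k1 := h8 (C ∩ C') Set.inter_subset_left (d2.subset Set.inter_subset_right)
        have e1 : A ∩ (C ∩ C') = A ∩ C' := by
          rw [← Set.inter_assoc, Set.inter_eq_left.2 h4]
        have e2 : (Y : Set N) ∩ (C ∩ C') = (Y : Set N) ∩ C' := by
          rw [← Set.inter_assoc, Set.inter_eq_left.2 h6]
        rw [e1, e2] at k1
        by_cases hyC' : y ∈ C'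
        · have k2 := ss_cut h3 d2 (fun h => hyC (h hyC'))
          have k3 : ((insert y Y : Finset N) : Set N) ∩ C' ⊆ insert y ((Y : Set N) ∩ C') := by
            rw [Finset.coe_insert]
            rintro x ⟨rfl | hx, hx'⟩
            · exact Or.inl rfl
            · exact Or.inr ⟨hx, hx'⟩
          have k4 := (Set.ncard_le_ncard k3 ((d2.subset Set.inter_subset_right).insert y)).trans
            (Set.ncard_insert_le _ _)
          omega
        · have k2 := ss_cut_le h3 d2
          have k3 : ((insert y Y : Finset N) : Set N) ∩ C' = (Y : Set N) ∩ C' := by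
            rw [Finset.coe_insert]
            ext x
            constructor
            · rintro ⟨rfl | hx, hx'⟩
              · exact absurd hx' hyC'
              · exact ⟨hx, hx'⟩
            · rintro ⟨hx, hx'⟩
              exact ⟨Or.inr hx, hx'⟩
          rw [k3]
          omega

end construction

section final

variable {L}
variable {N : Type} [L.Structure N]

/-- A point related to two points of a strong set is in the strong set. -/
lemma mem_strong [Finite (Σ n, L.Relations n)] (R3 : L.Relations 3) {W : Set N} (hW : W.Finite)
    (hWs : SelfSuffM L W) {t : Fin 3 → N} (ht : Language.Structure.RelMap R3 t)
    (h0 : t 0 ∈ W) (h1 : t 1 ∈ W) : t 2 ∈ W := by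
  by_contra h2
  have hlt := ss_lt hWs (hW.insert (t 2)) (Set.ssubset_insert h2)
  have c1 := Set.ncard_insert_of_notMem h2 hW
  have hn : (⟨3, R3, t⟩ : Σ n, L.Relations n × (Fin n → N)) ∉ relSet L W := fun h => h2 (h.1 2)
  have c2 := Set.ncard_insert_of_notMem hn (relSet_finite hW)
  have c3 : (insert (⟨3, R3, t⟩ : Σ n, L.Relations n × (Fin n → N)) (relSet L W)).ncard ≤
      (relSet L (insert (t 2) W)).ncard := by
    refine Set.ncard_le_ncard ?_ (relSet_finite (hW.insert _))
    refine Set.insert_subset ⟨?_, ht⟩ (relSet_mono (Set.subset_insert _ _))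
    intro i
    change t i ∈ _
    fin_cases i
    · exact Or.inr h0
    · exact Or.inr h1
    · exact Or.inl rfl
  simp only [delta_eq] at hlt
  omega

end final


/-- **Proposition 4.5**: let `M_f` be the generic structure for a good `f` with right
derivative `≤ 1/(2(x+1))`, let `b ∉ acl(ā)` and `P = loc(b/ā)`. Then for every `r` and
every `r`-tuple `ȳ` there is `x̄ ∈ P^{r+2}` with every entry of `ȳ` algebraic over
`x̄ ∪ ā`. -/
theorem locus_covers
    (L : FirstOrder.Language) [L.IsRelational]
    [Finite (Σ n, L.Relations n)] (R3 : L.Relations 3)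
    (f g : ℝ → ℝ) (hf : IsGoodFun f g)
    (hg : ∀ x ∈ Set.Ici (0 : ℝ), g x ≤ 1 / (2 * (x + 1)))
    (N : Type) [L.Structure N] [Countable N]
    (hgen : IsGeneric L (N := N) f)
    (k : ℕ) (a : Fin k → N) (b : N)
    (hb : ¬ inAcl L (Set.range a) b) :
    ∀ (r : ℕ) (y : Fin r → N), ∃ x : Fin (r + 2) → N,
      (∀ i : Fin (r + 2), (fun _ : Fin 1 => x i) ∈ locus L a (fun _ : Fin 1 => b)) ∧
      ∀ j : Fin r, inAcl L (Set.range a ∪ Set.range x) (y j) := by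
  classical
  intro r y
  obtain ⟨A, hAf, hAs, haA, hAmin⟩ := exists_cl (generic_cover hgen (Set.finite_range a))
  have hbA : b ∉ A := fun h => hb (cl_sub_acl hAf hAs haA hAmin h)
  obtain ⟨B, hBf, hBs, hB⟩ := generic_cover hgen (hAf.insert b)
  have hAB : A ⊆ B := (Set.subset_insert _ _).trans hB
  have hbB : b ∈ B := hB (Set.mem_insert _ _)
  obtain ⟨Y, C, hYc, hCf, hCs, hAC, hyC, hYC, hCmin, hYi⟩ :=
    exists_basis hgen hAf hAs hAmin (Finset.univ.image y)
  have hYr : Y.card ≤ r := hYc.trans (Finset.card_image_le.trans (by simp))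
  let st := amStr (edgeS R3 A hbB hYC)
  have : Finite A := hAf
  have hDf : ∀ j, Finite (pcs B C Y j) := by
    rintro (_ | j)
    · exact hCf
    · exact hBf
  have hrf : ∀ j, Finite ↥(relSub L (pcs B C Y j)) := hDf
  have hsub : ∀ D : Set N, Set.range (relSub L D).subtype = D := fun D => Subtype.range_coe
  obtain ⟨q, hq1, hq2⟩ := generic_ext hgen (relSub L (pcs B C Y none)).subtype
    (by rw [hsub]; exact hCs) (incE R3 hbB hbA hYC none)
    (am_kf hf hg hgen R3 hAs hAB hAC hbB hbA hYC hYi)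
    (am_strong R3 hAs hAB hAC hbB hbA hYC hYi none)
  obtain ⟨emb⟩ := Function.Embedding.nonempty_of_card_le (α := Option ↥Y) (β := Fin (r + 2))
    (by simp; omega)
  obtain ⟨σ, hσ⟩ : ∃ σ : Fin (r + 2) → Option ↥Y, Function.Surjective σ :=
    ⟨Function.invFun emb, Function.invFun_surjective emb.injective⟩
  let pt : Option ↥Y → N := fun i => q (AmT.inc (some i) ⟨b, hbB⟩)
  refine ⟨fun i => pt (σ i), fun i => ?_, fun j => ?_⟩
  · intro φ
    let p := q.comp (incE R3 hbB hbA hYC (some (σ i)))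
    have hp : SelfSuffM L (Set.range p) :=
      ss_comp q _ hq2 (am_strong R3 hAs hAB hAC hbB hbA hYC hYi _)
    let v : Fin (k + 1) → ↥(relSub L (pcs B C Y (some (σ i)))) :=
      Fin.append (fun l => ⟨a l, hAB (haA ⟨l, rfl⟩)⟩) (fun _ : Fin 1 => ⟨b, hbB⟩)
    have key := bf_realize hgen φ _ _ (hrf _) p (relSub L (pcs B C Y (some (σ i)))).subtype hp
      (by rw [hsub]; exact hBs) v default
    have e1 : p ∘ v = Fin.append a (fun _ : Fin 1 => pt (σ i)) := by
      funext l
      refine Fin.addCases (fun l => ?_) (fun l => ?_) l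
      · simp only [v, Function.comp_apply, Fin.append_left]
        have := hq1 ⟨a l, hAC (haA ⟨l, rfl⟩)⟩
        refine Eq.trans ?_ this
        change q _ = q _
        congr 1
        refine AmT.ext' ?_ rfl
        rw [AmT.lab_none.2, AmT.lab_none.2] <;> exact haA ⟨l, rfl⟩
      · simp only [v, Function.comp_apply, Fin.append_right]
        rfl
    have e2 : (relSub L (pcs B C Y (some (σ i)))).subtype ∘ v =
        Fin.append a (fun _ : Fin 1 => b) := by
      funext l
      refine Fin.addCases (fun l => ?_) (fun l => ?_) l
      · simp only [v, Function.comp_apply, Fin.append_left]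
        rfl
      · simp only [v, Function.comp_apply, Fin.append_right]
        rfl
    rw [e1, e2] at key
    have e3 : ∀ w : Fin 0 → N, w = default := fun w => Subsingleton.elim _ _
    rw [e3 (p ∘ default), e3 (_ ∘ default)] at key
    exact key
  · obtain ⟨W, hWf, hWs, hZW, hWmin⟩ := exists_cl (generic_cover hgen
      ((Set.finite_range a).union (Set.finite_range fun i => pt (σ i))))
    refine cl_sub_acl hWf hWs hZW hWmin ?_
    have hpt : ∀ i, pt i ∈ W := fun i => by
      obtain ⟨l, rfl⟩ := hσ i
      exact hZW (Or.inr ⟨l, rfl⟩)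
    have hYW : (Y : Set N) ⊆ W := by
      intro z hz
      have hr : Language.Structure.RelMap R3 (q ∘ edgeT A hbB hYC ⟨z, hz⟩) := by
        rw [q.map_rel]
        exact Or.inr ⟨⟨z, hz⟩, rfl⟩
      have := mem_strong R3 hWf hWs hr (hpt none) (hpt (some ⟨z, hz⟩))
      have e := hq1 ⟨z, hYC hz⟩
      change q _ = z at e
      rw [← e]
      exact this
    exact hCmin W hWs (fun z hz => hZW (Or.inl hz)) hYW (hyC (by simp))

end MeasureAmalgamation
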